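/- arXiv:2302.13641 — 4 statements merged into one kernel-verified Lean document; each statement's English description precedes it below -/
import Mathlib

section
/- Weak path reduction (increasing-type case): Let ℓ ≥ 1 and let a, b¹, …, bℓ, c be profiles, each profile x having a type t(x) ∈ ℝ and an outcome g(x) ∈ ℝ with g(x) ≥ 0. For a finite sequence of profiles define w(x¹, …, xᵏ) = Σ_{j=1}^{k−1} t(xʲ)·(g(xʲ⁺¹) − g(xʲ)). If t(a) ≤ t(b¹) ≤ ⋯ ≤ t(bℓ) and g(c) ≥ max_{1≤j≤ℓ} g(bʲ), then w(a, b¹, …, bℓ, c) ≥ w(a, c) = t(a)·(g(c) − g(a)). -/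
/-- The weight of a sequence of profiles: `w(x¹,…,xᵏ) = Σ_{j=1}^{k−1} t(xʲ)·(g(xʲ⁺¹) − g(xʲ))`. -/
def pathWeight {V : Type*} (t g : V → ℝ) : List V → ℝ
  | x :: y :: rest => t x * (g y - g x) + pathWeight t g (y :: rest)
  | _ => 0

theorem le_pathWeight_of_pairwise {V : Type*} (t g : V → ℝ) (c : V) (l : List V) (a : V)
    (ht : (a :: l).Pairwise fun x y => t x ≤ t y) (hg : ∀ x ∈ l, g x ≤ g c) :
    t a * (g c - g a) ≤ pathWeight t g (a :: (l ++ [c])) := by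
  induction l generalizing a with
  | nil => simp [pathWeight]
  | cons b l ih =>
    obtain ⟨hab, hbl⟩ := List.pairwise_cons.1 ht
    have hrec := ih b hbl fun x hx => hg x (List.mem_cons_of_mem b hx)
    have hprod := mul_nonneg (sub_nonneg.2 (hab b List.mem_cons_self))
      (sub_nonneg.2 (hg b List.mem_cons_self))
    simp only [List.cons_append, pathWeight]
    linarith

/-- **Weak path reduction (increasing-type case).** If `t a ≤ t b¹ ≤ ⋯ ≤ t bℓ` and
`g c ≥ g bʲ` for all `j`, then `w(a, b¹, …, bℓ, c) ≥ w(a, c) = t a · (g c − g a)`. -/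
theorem weak_path_reduction_increasing {V : Type*} (t g : V → ℝ)
    (hg : ∀ v, 0 ≤ g v)
    (ℓ : ℕ) (hℓ : 1 ≤ ℓ) (a c : V) (b : Fin ℓ → V)
    (hta : t a ≤ t (b ⟨0, hℓ⟩))
    (hmono : Monotone fun j => t (b j))
    (hgc : ∀ j, g (b j) ≤ g c) :
    t a * (g c - g a) ≤ pathWeight t g (a :: (List.ofFn b ++ [c])) := by
  refine le_pathWeight_of_pairwise t g c _ a (List.pairwise_cons.2 ⟨?_, ?_⟩) ?_
  · exact List.forall_mem_ofFn_iff.2 fun j => hta.trans (hmono (Nat.zero_le j))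
  · exact List.pairwise_ofFn.2 fun _ _ hij => hmono hij.le
  · exact List.forall_mem_ofFn_iff.2 hgc
end

section
/- Weak path reduction (decreasing-type case): Let ℓ ≥ 1 and let a, b¹, …, bℓ, c be profiles, each profile x having a type t(x) ∈ ℝ and an outcome g(x) ∈ ℝ with g(x) ≥ 0. For a finite sequence of profiles define w(x¹, …, xᵏ) = Σ_{j=1}^{k−1} t(xʲ)·(g(xʲ⁺¹) − g(xʲ)). If t(a) ≥ t(b¹) ≥ ⋯ ≥ t(bℓ) and g(c) ≤ min_{1≤j≤ℓ} g(bʲ), then w(a, b¹, …, bℓ, c) ≥ w(a, c) = t(a)·(g(c) − g(a)). -/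
/-- Deleting the interior of a path does not increase its weight when types decrease along the path
up to the endpoint and the endpoint has an outcome no larger than every interior one. -/
theorem mul_sub_le_pathWeight_cons_append_singleton {V : Type*} (t g : V → ℝ) (c : V) (l : List V)
    (a : V) (ht : (a :: l).Pairwise fun x y => t y ≤ t x) (hgc : ∀ x ∈ l, g c ≤ g x) :
    t a * (g c - g a) ≤ pathWeight t g (a :: (l ++ [c])) := by
  induction l generalizing a with
  | nil => simp [pathWeight]
  | cons x l ih =>
    obtain ⟨ha, hl⟩ := List.pairwise_cons.1 ht
    have hrest := ih x hl fun y hy => hgc y (List.mem_cons_of_mem x hy)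
    have htx : t x ≤ t a := ha x List.mem_cons_self
    have hgx : g c ≤ g x := hgc x List.mem_cons_self
    simp only [List.cons_append, pathWeight]
    linarith [mul_nonneg (sub_nonneg.2 htx) (sub_nonneg.2 hgx)]

/-- **Weak path reduction (decreasing-type case).** If `t a ≥ t b¹ ≥ ⋯ ≥ t bℓ` and
`g c ≤ g bʲ` for all `j`, then `w(a, b¹, …, bℓ, c) ≥ w(a, c) = t a · (g c − g a)`. -/
theorem weak_path_reduction_decreasing {V : Type*} (t g : V → ℝ)
    (hg : ∀ v, 0 ≤ g v)
    (ℓ : ℕ) (hℓ : 1 ≤ ℓ) (a c : V) (b : Fin ℓ → V)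
    (hta : t (b ⟨0, hℓ⟩) ≤ t a)
    (hanti : Antitone fun j => t (b j))
    (hgc : ∀ j, g c ≤ g (b j)) :
    t a * (g c - g a) ≤ pathWeight t g (a :: (List.ofFn b ++ [c])) := by
  refine mul_sub_le_pathWeight_cons_append_singleton t g c _ a (List.pairwise_cons.2 ⟨?_, ?_⟩) ?_
  · intro x hx
    obtain ⟨j, rfl⟩ := List.mem_ofFn.1 hx
    exact (hanti (Fin.mk_le_of_le_val j.val.zero_le)).trans hta
  · exact List.pairwise_ofFn.2 fun i j hij => hanti hij.le
  · intro x hx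
    obtain ⟨j, rfl⟩ := List.mem_ofFn.1 hx
    exact hgc j
end

section
/- Weak path replacement (increasing-type case): Let ℓ ≥ 1 and let a, b¹, …, bℓ, c be profiles and d a profile different from a and c, each profile x having a type t(x) ∈ ℝ and an outcome g(x) ∈ ℝ with g(x) ≥ 0. For a finite sequence of profiles define w(x¹, …, xᵏ) = Σ_{j=1}^{k−1} t(xʲ)·(g(xʲ⁺¹) − g(xʲ)). If t(a) ≤ t(d) ≤ t(b¹) ≤ ⋯ ≤ t(bℓ) and g(c) ≥ g(d) ≥ max_{1≤j≤ℓ} g(bʲ), then w(a, b¹, …, bℓ, c) ≥ w(a, d, c) = t(a)·(g(d) − g(a)) + t(d)·(g(c) − g(d)). -/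
/-- Along a path of nondecreasing types whose outcomes never exceed the final one, jumping directly
from the first profile to the last one does not increase the weight. -/
theorem mul_sub_le_pathWeight_append {V : Type*} (t g : V → ℝ) (c : V) :
    ∀ (l : List V) (x : V), (x :: l).Pairwise (fun u v => t u ≤ t v) → (∀ y ∈ l, g y ≤ g c) →
      t x * (g c - g x) ≤ pathWeight t g (x :: (l ++ [c]))
  | [], x, _, _ => by simp [pathWeight]
  | y :: l, x, ht, hgc => by
    have ih := mul_sub_le_pathWeight_append t g c l y ht.of_cons
      fun z hz => hgc z (List.mem_cons_of_mem y hz)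
    have hxy : t x ≤ t y := List.rel_of_pairwise_cons ht List.mem_cons_self
    have hy : g y ≤ g c := hgc y List.mem_cons_self
    simp only [List.cons_append, pathWeight]
    linarith [mul_le_mul_of_nonneg_right hxy (sub_nonneg.2 hy)]

/-- **Weak path replacement (increasing-type case).** If `t a ≤ t d ≤ t b¹ ≤ ⋯ ≤ t bℓ` and
`g c ≥ g d ≥ g bʲ` for all `j`, then
`w(a, b¹, …, bℓ, c) ≥ w(a, d, c) = t a · (g d − g a) + t d · (g c − g d)`. -/
theorem weak_path_replacement_increasing {V : Type*} (t g : V → ℝ)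
    (hg : ∀ v, 0 ≤ g v)
    (ℓ : ℕ) (hℓ : 1 ≤ ℓ) (a c d : V) (b : Fin ℓ → V)
    (hda : d ≠ a) (hdc : d ≠ c)
    (hta : t a ≤ t d) (htd : t d ≤ t (b ⟨0, hℓ⟩))
    (hmono : Monotone fun j => t (b j))
    (hgd : ∀ j, g (b j) ≤ g d) (hgc : g d ≤ g c) :
    t a * (g d - g a) + t d * (g c - g d) ≤ pathWeight t g (a :: (List.ofFn b ++ [c])) := by
  obtain ⟨n, rfl⟩ : ∃ n, ℓ = n + 1 := ⟨ℓ - 1, by omega⟩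
  have hsorted : (List.ofFn b).Pairwise (fun u v => t u ≤ t v) :=
    List.pairwise_ofFn.2 fun _ _ hij => hmono hij.le
  rw [List.ofFn_succ] at hsorted ⊢
  have hpath := mul_sub_le_pathWeight_append t g c _ _ hsorted fun y hy => by
    obtain ⟨j, rfl⟩ := (List.mem_ofFn' _ _).1 hy
    exact (hgd _).trans hgc
  have htd0 : t d ≤ t (b 0) := htd
  have hgd0 := hgd 0
  simp only [List.cons_append, pathWeight]
  linarith [mul_le_mul_of_nonneg_right htd0 (sub_nonneg.2 (hgd0.trans hgc)),
    mul_le_mul_of_nonneg_right hta (sub_nonneg.2 hgd0)]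
end

section
/- Weak path replacement (decreasing-type case): Let ℓ ≥ 1 and let a, b¹, …, bℓ, c be profiles and d a profile different from a and c, each profile x having a type t(x) ∈ ℝ and an outcome g(x) ∈ ℝ with g(x) ≥ 0. For a finite sequence of profiles define w(x¹, …, xᵏ) = Σ_{j=1}^{k−1} t(xʲ)·(g(xʲ⁺¹) − g(xʲ)). If t(a) ≥ t(d) ≥ t(b¹) ≥ ⋯ ≥ t(bℓ) and g(c) ≤ g(d) ≤ min_{1≤j≤ℓ} g(bʲ), then w(a, b¹, …, bℓ, c) ≥ w(a, d, c) = t(a)·(g(d) − g(a)) + t(d)·(g(c) − g(d)). -/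
/-- If types decrease along a path and `c` has the least outcome among the vertices after the
first, the path weighs at least as much as the direct step to `c`. -/
theorem direct_step_le_pathWeight {V : Type*} (t g : V → ℝ) (c : V) (L : List V) (x : V)
    (ht : (x :: L).Pairwise fun u v => t v ≤ t u) (hg : ∀ y ∈ L, g c ≤ g y) :
    t x * (g c - g x) ≤ pathWeight t g (x :: (L ++ [c])) := by
  induction L generalizing x with
  | nil => simp [pathWeight]
  | cons y L ih =>
    rw [List.pairwise_cons] at ht
    have hyx := ht.1 y List.mem_cons_self
    have hcy := hg y List.mem_cons_self
    have htail := ih y ht.2 fun z hz => hg z (List.mem_cons_of_mem y hz)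
    simp only [List.cons_append, pathWeight]
    nlinarith [mul_nonneg (sub_nonneg.2 hyx) (sub_nonneg.2 hcy)]

/-- **Weak path replacement (decreasing-type case).** If `t a ≥ t d ≥ t b¹ ≥ ⋯ ≥ t bℓ` and
`g c ≤ g d ≤ g bʲ` for all `j`, then
`w(a, b¹, …, bℓ, c) ≥ w(a, d, c) = t a · (g d − g a) + t d · (g c − g d)`. -/
theorem weak_path_replacement_decreasing {V : Type*} (t g : V → ℝ)
    (hg : ∀ v, 0 ≤ g v)
    (ℓ : ℕ) (hℓ : 1 ≤ ℓ) (a c d : V) (b : Fin ℓ → V)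
    (hda : d ≠ a) (hdc : d ≠ c)
    (hta : t d ≤ t a) (htd : t (b ⟨0, hℓ⟩) ≤ t d)
    (hanti : Antitone fun j => t (b j))
    (hgd : ∀ j, g d ≤ g (b j)) (hgc : g c ≤ g d) :
    t a * (g d - g a) + t d * (g c - g d) ≤ pathWeight t g (a :: (List.ofFn b ++ [c])) := by
  obtain ⟨n, rfl⟩ : ∃ n, ℓ = n + 1 := ⟨ℓ - 1, by omega⟩
  have hsorted : (List.ofFn b).Pairwise fun u v => t v ≤ t u :=
    List.pairwise_ofFn.2 fun _ _ hij => hanti hij.le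
  have hc : ∀ j, g c ≤ g (b j) := fun j => hgc.trans (hgd j)
  change t (b 0) ≤ t d at htd
  rw [List.ofFn_succ] at hsorted ⊢
  have htail := direct_step_le_pathWeight t g c _ _ hsorted
    (by simpa [List.mem_ofFn] using fun j : Fin n => hc j.succ)
  simp only [List.cons_append, pathWeight]
  nlinarith [mul_nonneg (sub_nonneg.2 hta) (sub_nonneg.2 (hgd 0)),
    mul_nonneg (sub_nonneg.2 htd) (sub_nonneg.2 (hc 0))]
end
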